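/- Let T be a tree on n vertices with diameter D = 4 whose central vertex u has at least three non-leaf neighbors, and let v₁,…,v_k be all neighbors of u labeled so that deg(v₁) ≤ … ≤ deg(v_k). If deg(v_k) − deg(v₁) ≥ 2, then the tree T′ obtained from T by deleting a pendant neighbor of v_k and attaching a new pendant vertex to v₁ satisfies ξ^ac(T) < ξ^ac(T′). -/

import Mathlib

open Finset SimpleGraph

/-- Degree of a vertex `u`: the number of neighbors of `u`. -/
noncomputable def deg {V : Type*} [Fintype V] (G : SimpleGraph V) (u : V) : ℕ :=
  {v | G.Adj u v}.ncard

/-- `M(u)`: the product of degrees of all neighbors of `u`. -/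
noncomputable def Mprod {V : Type*} [Fintype V] (G : SimpleGraph V) (u : V) : ℕ :=
  ∏ᶠ v ∈ {v | G.Adj u v}, deg G v

/-- Eccentricity of a vertex `u`: the maximum distance from `u` to any vertex. -/
noncomputable def ecc {V : Type*} [Fintype V] (G : SimpleGraph V) (u : V) : ℕ :=
  Finset.univ.sup fun v => G.dist u v

/-- Diameter of a graph: the maximum distance between two vertices. -/
noncomputable def gdiam {V : Type*} [Fintype V] (G : SimpleGraph V) : ℕ :=
  Finset.univ.sup fun u => ecc G u

/-- The augmented eccentric connectivity index `ξ^{ac}(G) = ∑_u M(u)/ε(u)`. -/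
noncomputable def xiAC {V : Type*} [Fintype V] (G : SimpleGraph V) : ℝ :=
  ∑ u : V, (Mprod G u : ℝ) / (ecc G u : ℝ)

section ParentGraph

variable {V : Type*}

/-- The graph in which every vertex is joined to its image under the parent map `p`. -/
def parentGraph (p : V → V) : SimpleGraph V :=
  SimpleGraph.fromRel fun x y => p x = y

theorem parentGraph_adj {p : V → V} {x y : V} :
    (parentGraph p).Adj x y ↔ x ≠ y ∧ (p x = y ∨ p y = x) :=
  Iff.rfl

theorem le_add_dist_of_adj {G : SimpleGraph V} (hG : G.Connected) (f : V → ℕ)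
    (hf : ∀ x y, G.Adj x y → f y ≤ f x + 1) (x y : V) : f y ≤ f x + G.dist x y := by
  obtain ⟨W, hW⟩ := hG.exists_walk_length_eq_dist x y
  rw [← hW]
  clear hW
  induction W with
  | nil => simp
  | cons h W ih =>
    have := hf _ _ h
    rw [SimpleGraph.Walk.length_cons]
    omega

theorem parentGraph_dist_parent_le (p : V → V) (x : V) : (parentGraph p).dist x (p x) ≤ 1 := by
  by_cases h : x = p x
  · rw [← h]; simp
  · exact (SimpleGraph.dist_eq_one_iff_adj.2 (parentGraph_adj.2 ⟨h, .inl rfl⟩)).le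

theorem parentGraph_reachable_parent (p : V → V) (x : V) :
    (parentGraph p).Reachable x (p x) := by
  by_cases h : x = p x
  · rw [← h]
  · exact SimpleGraph.Adj.reachable (parentGraph_adj.2 ⟨h, .inl rfl⟩)

theorem parentGraph_connected {p : V → V} {u : V} (hp : ∀ x, p (p x) = u) :
    (parentGraph p).Connected := by
  have h : ∀ x, (parentGraph p).Reachable x u := fun x => by
    have := (parentGraph_reachable_parent p x).trans (parentGraph_reachable_parent p (p x))
    rwa [hp] at this
  have : Nonempty V := ⟨u⟩
  exact ⟨fun x y => (h x).trans (h y).symm⟩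

variable [Fintype V]

theorem ecc_eq_of_forall_le {G : SimpleGraph V} {x y : V} {m : ℕ} (h : ∀ z, G.dist x z ≤ m)
    (hy : m ≤ G.dist x y) : ecc G x = m :=
  le_antisymm (Finset.sup_le fun z _ => h z)
    (hy.trans (Finset.le_sup (f := fun v => G.dist x v) (Finset.mem_univ y)))

theorem dist_le_gdiam (G : SimpleGraph V) (x y : V) : G.dist x y ≤ gdiam G :=
  (Finset.le_sup (f := fun v => G.dist x v) (Finset.mem_univ y)).trans
    (Finset.le_sup (f := fun v => ecc G v) (Finset.mem_univ x))

variable [DecidableEq V]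

/-- The children of the root `u`. -/
def rootChildren (p : V → V) (u : V) : Finset V :=
  Finset.univ.filter fun x => x ≠ u ∧ p x = u

/-- The vertices whose parent is `v`. -/
def fiber (p : V → V) (v : V) : Finset V :=
  Finset.univ.filter fun x => p x = v

variable {p : V → V} {u : V}

theorem mem_rootChildren {x : V} : x ∈ rootChildren p u ↔ x ≠ u ∧ p x = u := by
  simp [rootChildren]

theorem mem_fiber {v x : V} : x ∈ fiber p v ↔ p x = v := by
  simp [fiber]

theorem neighbors_root (hu : p u = u) :
    {y | (parentGraph p).Adj u y} = ↑(rootChildren p u) := by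
  ext y
  simp only [Set.mem_ofPred_eq, parentGraph_adj, Finset.mem_coe, mem_rootChildren, hu]
  tauto

theorem neighbors_child {v : V} (hv : v ∈ rootChildren p u) :
    {y | (parentGraph p).Adj v y} = ↑(insert u (fiber p v)) := by
  rw [mem_rootChildren] at hv
  ext y
  simp only [Set.mem_ofPred_eq, parentGraph_adj, Finset.mem_coe, Finset.mem_insert, mem_fiber]
  grind

omit [Fintype V] [DecidableEq V] in
theorem neighbors_grandchild (hp : ∀ x, p (p x) = u) {x : V} (hx : p x ≠ u) :
    {y | (parentGraph p).Adj x y} = ↑({p x} : Finset V) := by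
  ext y
  simp only [Set.mem_ofPred_eq, parentGraph_adj, Finset.mem_coe, Finset.mem_singleton]
  grind

theorem root_notMem_fiber (hu : p u = u) {v : V} (hv : v ∈ rootChildren p u) :
    u ∉ fiber p v := by
  rw [mem_rootChildren] at hv
  rw [mem_fiber, hu]
  exact hv.1.symm

theorem deg_root (hu : p u = u) : deg (parentGraph p) u = (rootChildren p u).card := by
  rw [deg, neighbors_root hu, Set.ncard_coe_finset]

theorem deg_child (hu : p u = u) {v : V} (hv : v ∈ rootChildren p u) :
    deg (parentGraph p) v = (fiber p v).card + 1 := by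
  rw [deg, neighbors_child hv, Set.ncard_coe_finset,
    Finset.card_insert_of_notMem (root_notMem_fiber hu hv)]

omit [DecidableEq V] in
theorem deg_grandchild (hp : ∀ x, p (p x) = u) {x : V} (hx : p x ≠ u) :
    deg (parentGraph p) x = 1 := by
  rw [deg, neighbors_grandchild hp hx, Set.ncard_coe_finset, Finset.card_singleton]

theorem Mprod_root (hu : p u = u) :
    Mprod (parentGraph p) u = ∏ v ∈ rootChildren p u, ((fiber p v).card + 1) := by
  rw [Mprod, neighbors_root hu, finprod_mem_coe_finset]
  exact Finset.prod_congr rfl fun v hv => deg_child hu hv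

theorem Mprod_child (hu : p u = u) (hp : ∀ x, p (p x) = u) {v : V}
    (hv : v ∈ rootChildren p u) : Mprod (parentGraph p) v = (rootChildren p u).card := by
  rw [Mprod, neighbors_child hv, finprod_mem_coe_finset,
    Finset.prod_insert (root_notMem_fiber hu hv), deg_root hu, Finset.prod_eq_one, mul_one]
  intro x hx
  refine deg_grandchild hp ?_
  rw [mem_fiber.1 hx]
  exact (mem_rootChildren.1 hv).1

theorem Mprod_grandchild (hu : p u = u) (hp : ∀ x, p (p x) = u) {x : V} (hx : p x ≠ u) :
    Mprod (parentGraph p) x = (fiber p (p x)).card + 1 := by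
  rw [Mprod, neighbors_grandchild hp hx, finprod_mem_coe_finset, Finset.prod_singleton,
    deg_child hu (mem_rootChildren.2 ⟨hx, hp x⟩)]

/-- Distance to the root in a rooted tree of height at most two. -/
def height (p : V → V) (u x : V) : ℕ :=
  if x = u then 0 else if p x = u then 1 else 2

omit [Fintype V] in
theorem dist_root_le (hp : ∀ x, p (p x) = u) (x : V) :
    (parentGraph p).dist x u ≤ height p u x := by
  unfold height
  have h1 := parentGraph_dist_parent_le p x
  have h2 := parentGraph_dist_parent_le p (p x)
  have h3 := (parentGraph_connected hp).dist_triangle (u := x) (v := p x) (w := p (p x))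
  rw [hp] at h2 h3
  split_ifs with h h'
  · simp [h]
  · rwa [h'] at h1
  · omega

omit [Fintype V] in
theorem dist_le_height_add (hp : ∀ x, p (p x) = u) (x y : V) :
    (parentGraph p).dist x y ≤ height p u x + height p u y := by
  have h1 := dist_root_le hp x
  have h2 := dist_root_le hp y
  have h3 := (parentGraph_connected hp).dist_triangle (u := x) (v := u) (w := y)
  rw [SimpleGraph.dist_comm (u := u)] at h3
  omega

omit [Fintype V] in
theorem height_le_two (x : V) : height p u x ≤ 2 := by
  unfold height
  split_ifs <;> omega

theorem height_add_le_dist (hu : p u = u) (hp : ∀ x, p (p x) = u) {c x y : V}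
    (hc : c ∈ rootChildren p u) (hx : x = u ∨ x = c ∨ p x = c) (hy : y ≠ c ∧ p y ≠ c) :
    height p u x + height p u y ≤ (parentGraph p).dist x y := by
  rw [mem_rootChildren] at hc
  have key := le_add_dist_of_adj (parentGraph_connected hp)
    (fun z => if z = c ∨ p z = c then 2 - height p u z else 2 + height p u z) (by
      intro a b hab
      rw [parentGraph_adj] at hab
      have ha := hp a
      have hb := hp b
      simp only [height]
      grind) x y
  have h2 := height_le_two (p := p) (u := u) x
  simp only [hy.1, hy.2, or_self, if_false] at key
  rcases hx with rfl | hx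
  · simp only [height] at *
    grind
  · simp only [hx, if_true] at key
    omega

theorem ecc_parentGraph (hu : p u = u) (hp : ∀ x, p (p x) = u) {a b : V}
    (ha : p a ∈ rootChildren p u) (hb : p b ∈ rootChildren p u) (hpab : p a ≠ p b) (x : V) :
    ecc (parentGraph p) x = height p u x + 2 := by
  have hle : ∀ z, (parentGraph p).dist x z ≤ height p u x + 2 := fun z =>
    (dist_le_height_add hp x z).trans (Nat.add_le_add_left (height_le_two z) _)
  have hht : ∀ y, p y ∈ rootChildren p u → height p u y = 2 := by
    intro y hy
    rw [mem_rootChildren] at hy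
    unfold height
    grind
  have main : ∀ c ∈ rootChildren p u, (x = u ∨ x = c ∨ p x = c) →
      ecc (parentGraph p) x = height p u x + 2 := by
    intro c hc hx
    have hc' := mem_rootChildren.1 hc
    rw [mem_rootChildren] at ha hb
    by_cases hac : p a = c
    · refine ecc_eq_of_forall_le (y := b) hle ?_
      have := height_add_le_dist hu hp hc hx (y := b) (by grind)
      rwa [hht b (mem_rootChildren.2 hb)] at this
    · refine ecc_eq_of_forall_le (y := a) hle ?_
      have := height_add_le_dist hu hp hc hx (y := a) (by grind)
      rwa [hht a (mem_rootChildren.2 ha)] at this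
  by_cases hxu : x = u
  · exact main _ ha (.inl hxu)
  by_cases hpx : p x = u
  · exact main x (mem_rootChildren.2 ⟨hxu, hpx⟩) (.inr (.inl rfl))
  · exact main (p x) (mem_rootChildren.2 ⟨hpx, hp x⟩) (.inr (.inr rfl))

theorem xiAC_parentGraph (hu : p u = u) (hp : ∀ x, p (p x) = u) {a b : V}
    (ha : p a ∈ rootChildren p u) (hb : p b ∈ rootChildren p u) (hpab : p a ≠ p b) :
    xiAC (parentGraph p) =
      (∏ v ∈ rootChildren p u, ((fiber p v).card + 1 : ℝ)) / 2 +
      ((rootChildren p u).card : ℝ) ^ 2 / 3 +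
      ∑ v ∈ rootChildren p u, ((fiber p v).card : ℝ) * ((fiber p v).card + 1) / 4 := by
  have hecc := ecc_parentGraph hu hp ha hb hpab
  have hsplit : (Finset.univ : Finset V) =
      insert u (rootChildren p u ∪ Finset.univ.filter fun x => p x ∈ rootChildren p u) := by
    ext x
    have := hp x
    simp only [Finset.mem_univ, Finset.mem_insert, Finset.mem_union, Finset.mem_filter,
      mem_rootChildren, true_and, true_iff]
    tauto
  have hdisj : Disjoint (rootChildren p u)
      (Finset.univ.filter fun x => p x ∈ rootChildren p u) := by
    rw [Finset.disjoint_left]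
    intro x
    simp only [mem_rootChildren, Finset.mem_filter]
    tauto
  have hnot : u ∉ rootChildren p u ∪ Finset.univ.filter fun x => p x ∈ rootChildren p u := by
    simp [mem_rootChildren, hu]
  rw [xiAC, hsplit, Finset.sum_insert hnot, Finset.sum_union hdisj, ← add_assoc]
  congr 1
  · congr 1
    · rw [Mprod_root hu, hecc]
      simp [height]
    · rw [Finset.sum_congr rfl (g := fun _ => ((rootChildren p u).card : ℝ) / 3),
        Finset.sum_const, nsmul_eq_mul]
      · ring
      · intro v hv
        have hv' := mem_rootChildren.1 hv
        rw [Mprod_child hu hp hv, hecc]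
        norm_num [height, hv'.1, hv'.2]
  · rw [← Finset.sum_fiberwise_of_maps_to (g := p) (t := rootChildren p u)
      (fun x hx => (Finset.mem_filter.1 hx).2)]
    refine Finset.sum_congr rfl fun v hv => ?_
    have hv' := mem_rootChildren.1 hv
    have hfib : (Finset.univ.filter fun x => p x ∈ rootChildren p u).filter
        (fun x => p x = v) = fiber p v := by
      ext x
      simp only [Finset.mem_filter, Finset.mem_univ, true_and, mem_fiber]
      constructor
      · exact fun h => h.2
      · exact fun h => ⟨h ▸ hv, h⟩
    rw [hfib, Finset.sum_congr rfl (g := fun _ => ((fiber p v).card + 1 : ℝ) / 4),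
      Finset.sum_const, nsmul_eq_mul]
    · ring
    · intro x hx
      have hx' := mem_fiber.1 hx
      have hxu : x ≠ u := by
        rintro rfl
        exact hv'.1 (hx'.symm.trans hu)
      rw [Mprod_grandchild hu hp (hx' ▸ hv'.1), hecc, hx']
      norm_num [height, hxu, hx', hv'.1]

end ParentGraph

section Tree

variable {V : Type*} {T : SimpleGraph V}

theorem SimpleGraph.IsTree.eq_of_adj_of_dist_lt (hT : T.IsTree) {x u q r : V} (hq : T.Adj u q)
    (hr : T.Adj u r) (hqx : T.dist q x < T.dist u x) (hrx : T.dist r x < T.dist u x) :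
    q = r := by
  obtain ⟨P, hP, hPl⟩ := hT.connected.exists_path_of_dist q x
  obtain ⟨Q, hQ, hQl⟩ := hT.connected.exists_path_of_dist r x
  have hnot : ∀ {y : V} (W : T.Walk y x), W.length < T.dist u x → u ∉ W.support := by
    classical
    intro y W hW hu
    have h1 := SimpleGraph.dist_le (W.dropUntil u hu)
    have h2 := W.length_dropUntil_le_length hu
    omega
  have hPu : (SimpleGraph.Walk.cons hq P).IsPath := hP.cons (hnot P (by omega))
  have hQu : (SimpleGraph.Walk.cons hr Q).IsPath := hQ.cons (hnot Q (by omega))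
  have h := (hT.existsUnique_path u x).unique hPu hQu
  simpa using congrArg SimpleGraph.Walk.snd h

theorem SimpleGraph.IsTree.dist_eq_add_one (hT : T.IsTree) {x u q : V} (hq : T.Adj u q)
    (h : ¬ T.dist q x < T.dist u x) : T.dist q x = T.dist u x + 1 := by
  have h1 := hT.dist_ne_of_adj x hq
  have h2 := hT.connected.dist_triangle (u := q) (v := u) (w := x)
  rw [SimpleGraph.dist_eq_one_iff_adj.2 hq.symm] at h2
  rw [SimpleGraph.dist_comm (u := x), SimpleGraph.dist_comm (u := x)] at h1
  omega

variable [Fintype V]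

theorem exists_adj_ne_of_deg_ne_one {u q : V} (huq : T.Adj u q) (h : deg T q ≠ 1) :
    ∃ r, T.Adj q r ∧ r ≠ u := by
  by_contra! hcon
  apply h
  rw [deg, Set.ncard_eq_one]
  refine ⟨u, ?_⟩
  ext r
  exact ⟨fun hr => hcon r hr, fun hr => hr ▸ huq.symm⟩

theorem SimpleGraph.IsTree.dist_le_two (hT : T.IsTree) (hdiam : gdiam T ≤ 4) {u : V}
    (hnonleaf : 2 ≤ {v | T.Adj u v ∧ deg T v ≠ 1}.ncard) (x : V) : T.dist u x ≤ 2 := by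
  by_contra! hx
  obtain ⟨a, b, ha, hb, hab⟩ := (Set.one_lt_ncard_iff (Set.toFinite _)).1 hnonleaf
  obtain ⟨q, ⟨huq, hq1⟩, hqx⟩ :
      ∃ q, (T.Adj u q ∧ deg T q ≠ 1) ∧ ¬ T.dist q x < T.dist u x := by
    by_contra! hcon
    exact hab (hT.eq_of_adj_of_dist_lt ha.1 hb.1 (hcon a ha) (hcon b hb))
  obtain ⟨r, hqr, hru⟩ := exists_adj_ne_of_deg_ne_one huq hq1
  have h1 := hT.dist_eq_add_one huq hqx
  have h2 : ¬ T.dist r x < T.dist q x := fun h =>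
    hru (hT.eq_of_adj_of_dist_lt hqr huq.symm h (by omega))
  have h3 := hT.dist_eq_add_one hqr h2
  have h4 := dist_le_gdiam T r x
  omega

omit [Fintype V] in
theorem SimpleGraph.IsTree.exists_eq_parentGraph (hT : T.IsTree) {u : V}
    (hu : ∀ x, T.dist u x ≤ 2) :
    ∃ p : V → V, p u = u ∧ (∀ x, p (p x) = u) ∧ T = parentGraph p := by
  classical
  have hex : ∀ x, ∃ y, (x = u → y = u) ∧ (T.Adj u x → y = u) ∧
      (x ≠ u → T.Adj x y) ∧ (y = u ∨ T.Adj u y) := by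
    intro x
    by_cases hxu : x = u
    · exact ⟨u, by simp [hxu]⟩
    by_cases hux : T.Adj u x
    · exact ⟨u, by simp [hux.symm]⟩
    obtain ⟨W, hW⟩ := hT.connected.exists_walk_length_eq_dist u x
    have h2 := hu x
    rw [← hW] at h2
    match W, h2 with
    | .nil, _ => exact absurd rfl hxu
    | .cons h .nil, _ => exact absurd h hux
    | .cons (v := y) h (.cons h' .nil), _ =>
      exact ⟨y, fun h => absurd h hxu, fun h => absurd h hux, fun _ => h'.symm, .inr h⟩
  choose p hp1 hp2 hp3 hp4 using hex
  have hpp : ∀ x, p (p x) = u := fun x => (hp4 x).elim (hp1 _) (hp2 _)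
  refine ⟨p, hp1 u rfl, hpp, ?_⟩
  have hle : parentGraph p ≤ T := by
    have hpar : ∀ x y, x ≠ y → p x = y → T.Adj x y := by
      rintro x y hxy rfl
      refine hp3 x ?_
      rintro rfl
      exact hxy (hp1 x rfl).symm
    intro x y hxy
    obtain ⟨hne, h | h⟩ := parentGraph_adj.1 hxy
    · exact hpar x y hne h
    · exact (hpar y x hne.symm h).symm
  exact le_antisymm
    ((SimpleGraph.isTree_iff_minimal_connected.1 hT).2 (parentGraph_connected hpp) hle) hle

end Tree

theorem parentGraph_update {V : Type*} [DecidableEq V] {p : V → V} {v w : V}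
    (hw : ∀ x, p x ≠ w) (hv : v ≠ w) :
    fromEdgeSet (((parentGraph p).edgeSet \ {s(p w, w)}) ∪ {s(v, w)}) =
      parentGraph (Function.update p w v) := by
  ext x y
  have hx := hw x
  have hy := hw y
  simp only [fromEdgeSet_adj, Set.mem_union, Set.mem_sdiff, SimpleGraph.mem_edgeSet,
    Set.mem_singleton_iff, parentGraph_adj, Sym2.eq_iff, Function.update_apply]
  grind

theorem balance_sum_prod_lt {V : Type*} [DecidableEq V] {S : Finset V} {a b q : V}
    {c c' : V → ℕ} (ha : a ∈ S) (hb : b ∈ S) (hq : q ∈ S) (hqa : q ≠ a) (hqb : q ≠ b)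
    (hab : c a + 2 ≤ c b) (hcq : 1 ≤ c q) (hca : c' a = c a + 1) (hcb : c' b + 1 = c b)
    (hc : ∀ x ∈ S, x ≠ a → x ≠ b → c' x = c x) :
    (∏ v ∈ S, ((c v : ℝ) + 1)) / 2 + ∑ v ∈ S, (c v : ℝ) * (c v + 1) / 4 <
      (∏ v ∈ S, ((c' v : ℝ) + 1)) / 2 + ∑ v ∈ S, (c' v : ℝ) * (c' v + 1) / 4 := by
  have hne : a ≠ b := by
    rintro rfl
    omega
  have hb' : b ∈ S.erase a := Finset.mem_erase.2 ⟨hne.symm, hb⟩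
  have hq' : q ∈ (S.erase a).erase b :=
    Finset.mem_erase.2 ⟨hqb, Finset.mem_erase.2 ⟨hqa, hq⟩⟩
  have hcR : ∀ x ∈ (S.erase a).erase b, c' x = c x := by
    intro x hx
    simp only [Finset.mem_erase] at hx
    exact hc x hx.2.2 hx.2.1 hx.1
  rw [← Finset.mul_prod_erase S _ ha, ← Finset.mul_prod_erase _ _ hb',
    ← Finset.add_sum_erase S _ ha, ← Finset.add_sum_erase _ _ hb',
    ← Finset.mul_prod_erase S (fun v => (c' v : ℝ) + 1) ha, ← Finset.mul_prod_erase _ _ hb',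
    ← Finset.add_sum_erase S (fun v => (c' v : ℝ) * (c' v + 1) / 4) ha,
    ← Finset.add_sum_erase _ _ hb',
    Finset.prod_congr rfl fun x hx => congrArg (fun n : ℕ => (n : ℝ) + 1) (hcR x hx),
    Finset.sum_congr rfl fun x hx =>
      congrArg (fun n : ℕ => (n : ℝ) * (n + 1) / 4) (hcR x hx)]
  have hP : (2 : ℝ) ≤ ∏ v ∈ (S.erase a).erase b, ((c v : ℝ) + 1) := by
    have h1 : c q + 1 ≤ ∏ v ∈ (S.erase a).erase b, (c v + 1) :=
      Finset.single_le_prod' (f := fun v => c v + 1) (fun _ _ => by omega) hq'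
    have h2 : 2 ≤ ∏ v ∈ (S.erase a).erase b, (c v + 1) := by omega
    exact_mod_cast h2
  have hcb' : (c b : ℝ) = c' b + 1 := by exact_mod_cast hcb.symm
  have hgap : (c a : ℝ) + 1 ≤ c' b := by
    have : c a + 1 ≤ c' b := by omega
    exact_mod_cast this
  rw [hca, hcb']
  push_cast
  generalize ∏ v ∈ (S.erase a).erase b, ((c v : ℝ) + 1) = P at *
  nlinarith [mul_nonneg (sub_nonneg.2 hgap) (sub_nonneg.2 hP)]

/-- Lemma: Let `T` be a tree of diameter 4 whose central vertex `u` has at least three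
non-leaf neighbors, let `v₁` be a neighbor of `u` of minimum degree and `vₖ` a neighbor
of maximum degree. If `deg(vₖ) - deg(v₁) ≥ 2`, the tree `T'` obtained by deleting a
pendant neighbor `w` of `vₖ` and attaching it as a pendant vertex to `v₁` satisfies
`ξ^{ac}(T) < ξ^{ac}(T')`. -/
theorem xiAC_balance_step {V : Type*} [Fintype V] (T : SimpleGraph V)
    (hT : T.IsTree) (hdiam : gdiam T = 4)
    (u : V) (hcentral : ∀ v, ecc T u ≤ ecc T v)
    (hnonleaf : 3 ≤ {v | T.Adj u v ∧ deg T v ≠ 1}.ncard)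
    (v1 vk : V) (hv1 : T.Adj u v1) (hvk : T.Adj u vk)
    (hmin : ∀ v, T.Adj u v → deg T v1 ≤ deg T v)
    (hmax : ∀ v, T.Adj u v → deg T v ≤ deg T vk)
    (hgap : deg T v1 + 2 ≤ deg T vk)
    (w : V) (hw : T.Adj vk w) (hwleaf : deg T w = 1)
    (T' : SimpleGraph V)
    (hT' : T' = fromEdgeSet ((T.edgeSet \ {s(vk, w)}) ∪ {s(v1, w)})) :
    xiAC T < xiAC T' := by
  classical
  obtain ⟨p, hu, hp, rfl⟩ := hT.exists_eq_parentGraph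
    (hT.dist_le_two hdiam.le (u := u) (by omega))
  have hS : ∀ v, (parentGraph p).Adj u v ↔ v ∈ rootChildren p u := fun v =>
    Set.ext_iff.1 (neighbors_root hu) v
  rw [hS] at hv1 hvk
  have hv1' := mem_rootChildren.1 hv1
  have hvk' := mem_rootChildren.1 hvk
  rw [deg_child hu hv1, deg_child hu hvk] at hgap
  obtain ⟨q, ⟨hq, hq1⟩, hqn⟩ := Set.exists_mem_notMem_of_ncard_lt_ncard
    (s := {v1, vk}) (t := {v | (parentGraph p).Adj u v ∧ deg (parentGraph p) v ≠ 1})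
    (by rw [Set.ncard_pair (by rintro rfl; omega)]; omega)
  simp only [Set.mem_insert_iff, Set.mem_singleton_iff, not_or] at hqn
  rw [hS] at hq
  rw [deg_child hu hq] at hq1
  have hwu : w ≠ u := by
    rintro rfl
    have h1 : {v | (parentGraph p).Adj w v ∧ deg (parentGraph p) v ≠ 1}.ncard ≤
        deg (parentGraph p) w := Set.ncard_le_ncard (fun v hv => hv.1) (Set.toFinite _)
    omega
  have hpw : p w = vk := (parentGraph_adj.1 hw).2.resolve_left fun h =>
    hwu (h.symm.trans hvk'.2)
  subst hpw
  have hnot : ∀ x, p x ≠ w := fun x hx => hvk'.1 (hx ▸ hp x)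
  have hv1w : v1 ≠ w := by
    rintro rfl
    exact hvk'.1 hv1'.2
  rw [parentGraph_update hnot hv1w] at hT'
  subst hT'
  have hne : v1 ≠ p w := by
    intro h
    rw [← h] at hgap
    omega
  have hcard1 : (fiber (Function.update p w v1) v1).card = (fiber p v1).card + 1 := by
    have : fiber (Function.update p w v1) v1 = insert w (fiber p v1) := by
      ext x
      simp only [mem_fiber, Finset.mem_insert, Function.update_apply]
      grind
    rw [this, Finset.card_insert_of_notMem]
    rw [mem_fiber]
    exact hne.symm
  have hcardk : (fiber (Function.update p w v1) (p w)).card + 1 = (fiber p (p w)).card := by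
    have : fiber (Function.update p w v1) (p w) = (fiber p (p w)).erase w := by
      ext x
      simp only [mem_fiber, Finset.mem_erase, Function.update_apply]
      grind
    rw [this, Finset.card_erase_add_one (mem_fiber.2 rfl)]
  have hcard : ∀ x, x ≠ v1 → x ≠ p w →
      (fiber (Function.update p w v1) x).card = (fiber p x).card := by
    intro x hx1 hxk
    congr 1
    ext y
    simp only [mem_fiber, Function.update_apply]
    grind
  have hchildren : rootChildren (Function.update p w v1) u = rootChildren p u := by
    ext x
    simp only [mem_rootChildren, Function.update_apply]
    grind
  have hu' : Function.update p w v1 u = u := by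
    rw [Function.update_of_ne hwu.symm, hu]
  have hp' : ∀ x, Function.update p w v1 (Function.update p w v1 x) = u := by
    intro x
    have := hp x
    have := hnot x
    simp only [Function.update_apply]
    grind
  obtain ⟨b, hb⟩ : (fiber p q).Nonempty := Finset.card_pos.1 (by omega)
  obtain ⟨d, hd⟩ : (fiber (Function.update p w v1) (p w)).Nonempty :=
    Finset.card_pos.1 (by omega)
  rw [mem_fiber] at hb hd
  have hw1 : Function.update p w v1 w = v1 := Function.update_self ..
  rw [xiAC_parentGraph hu hp hvk (hb ▸ hq) (hb ▸ Ne.symm hqn.2),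
    xiAC_parentGraph hu' hp' (a := w) (b := d) (by rwa [hw1, hchildren])
      (by rwa [hd, hchildren]) (by rwa [hw1, hd]), hchildren]
  have := balance_sum_prod_lt (c := fun v => (fiber p v).card)
    (c' := fun v => (fiber (Function.update p w v1) v).card)
    hv1 hvk hq hqn.1 hqn.2 (by omega) (by omega) hcard1 hcardk (fun x _ => hcard x)
  linarith
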